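/- Let b be a list of integers and let J denote the 2×2 integer matrix [[-1,0],[0,1]]. Then J · M(b) = (-1)^{|b|} · M(-b) · J, where |b| denotes the length of b and -b denotes the list b with every entry negated. (This is the key displayed identity in the proof of Lemma 4.1 of the paper.) -/

import Mathlib

/-- The 2×2 integer matrix associated to a continued fraction expansion:
the product of the matrices `!![rᵢ, 1; 1, 0]` over the entries of the list,
with the empty product equal to the identity. -/
def cfM (l : List ℤ) : Matrix (Fin 2) (Fin 2) ℤ :=
  (l.map (fun r => !![r, 1; 1, 0])).prod

theorem cfM_cons (r : ℤ) (l : List ℤ) : cfM (r :: l) = !![r, 1; 1, 0] * cfM l := by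
  simp [cfM]

theorem J_mul_step (r : ℤ) :
    !![(-1 : ℤ), 0; 0, 1] * !![r, 1; 1, 0] = -(!![-r, 1; 1, 0] * !![(-1 : ℤ), 0; 0, 1]) := by
  ext i j
  fin_cases i <;> fin_cases j <;> simp

/-- The key displayed identity in the proof of Lemma 4.1 of the paper:
`J * M(b) = (-1)^{|b|} • M(-b) * J` where `J = !![-1, 0; 0, 1]`. -/
theorem J_mul_cfM (b : List ℤ) :
    !![(-1 : ℤ), 0; 0, 1] * cfM b =
      ((-1 : ℤ) ^ b.length) • (cfM (b.map (fun x => -x)) * !![(-1 : ℤ), 0; 0, 1]) := by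
  induction b with
  | nil => simp [cfM]
  | cons r l ih =>
    rw [cfM_cons, ← mul_assoc, J_mul_step, neg_mul, mul_assoc, ih, List.map_cons, cfM_cons,
      List.length_cons, pow_succ, mul_smul_comm, mul_neg_one, neg_smul, mul_assoc]
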